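/- For all m ≥ m₀, all 0 ≤ j < 3^m and all k ≥ 1: D_{m+k} f(j/3^m + 3^{−(m+1)} + 3^{−(m+2)} + … + 3^{−(m+k)}) = D_m f(j/3^m) / ∏_{i=1}^{k} (1 − λ_{m+i}/3). -/

import Mathlib

open scoped BigOperators

noncomputable section

namespace VNLE

/-- `N_m = 2·5^m`, the number of points on the circle at level `m`. -/
def Nm (m : ℕ) : ℕ := 2 * 5 ^ m

/-- The partner of a vertex `n` of `K_m`: writing the representative `v` of `n`
(taking `v = 2·5^m` when `n = 0`) as `v = 5^k·a` with `5 ∤ a`, the partner is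
`n + 5^k` if `a ≡ 1` or `3 (mod 5)`, and `n - 5^k` if `a ≡ 2` or `4 (mod 5)`.
This realizes the identifications `5^k(1+5j) ∼ 5^k(2+5j)` and
`5^k(3+5j) ∼ 5^k(4+5j)` in `ℤ/(2·5^m)ℤ`. -/
def partner (m : ℕ) (n : ZMod (Nm m)) : ZMod (Nm m) :=
  let v : ℕ := if n.val = 0 then Nm m else n.val
  let k : ℕ := padicValNat 5 v
  if (v / 5 ^ k) % 5 = 1 ∨ (v / 5 ^ k) % 5 = 3 then n + ((5 ^ k : ℕ) : ZMod (Nm m))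
  else n - ((5 ^ k : ℕ) : ZMod (Nm m))

/-- A function on `K_m`: a map on `ℤ/N_mℤ` constant on the identified pairs. -/
def IsKFun (m : ℕ) (u : ZMod (Nm m) → ℝ) : Prop := ∀ n, u (partner m n) = u n

/-- The graph Laplacian `−Δ_m`. -/
def lap (m : ℕ) (u : ZMod (Nm m) → ℝ) : ZMod (Nm m) → ℝ := fun n =>
  4 * u n - u (n + 1) - u (n - 1) - u (partner m n + 1) - u (partner m n - 1)

/-- `u` is a `λ`-eigenfunction of `−Δ_m`. -/
def IsEigen (m : ℕ) (lam : ℝ) (u : ZMod (Nm m) → ℝ) : Prop :=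
  IsKFun m u ∧ u ≠ 0 ∧ ∀ n, lap m u n = lam * u n

/-- The spectral decimation renormalization polynomial `R(x) = x(3−x)(5−x)`. -/
def R (x : ℝ) : ℝ := x * (3 - x) * (5 - x)

/-- The `λ'`-extension of a function on `K_m` to a function on `K_{m+1}`. -/
def extFun (m : ℕ) (lam' : ℝ) (u : ZMod (Nm m) → ℝ) : ZMod (Nm (m + 1)) → ℝ := fun x =>
  let n : ZMod (Nm m) := ((x.val / 5 : ℕ) : ZMod (Nm m))
  if x.val % 5 = 0 then u n
  else if x.val % 5 = 1 ∨ x.val % 5 = 2 then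
    ((2 - lam') * u n + u (n + 1)) / ((1 - lam') * (3 - lam'))
  else
    (u n + (2 - lam') * u (n + 1)) / ((1 - lam') * (3 - lam'))

/-- Restriction of a function on `K_{m+1}` to the old vertices, giving a function on `K_m`. -/
def down (m : ℕ) (v : ZMod (Nm (m + 1)) → ℝ) : ZMod (Nm m) → ℝ := fun n =>
  v (((5 * n.val : ℕ) : ZMod (Nm (m + 1))))

/-- The Laplacian `−Δ_m` as a linear map. -/
def lapL (m : ℕ) : (ZMod (Nm m) → ℝ) →ₗ[ℝ] (ZMod (Nm m) → ℝ) where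
  toFun := lap m
  map_add' u v := by funext n; simp only [lap, Pi.add_apply]; ring
  map_smul' c u := by funext n; simp only [lap, Pi.smul_apply, smul_eq_mul, RingHom.id_apply]; ring

/-- The subspace of functions on `K_m` (maps constant on identified pairs). -/
def KFunSub (m : ℕ) : Submodule ℝ (ZMod (Nm m) → ℝ) where
  carrier := {u | IsKFun m u}
  add_mem' := by
    intro u v hu hv n
    simp only [Pi.add_apply, hu n, hv n]
  zero_mem' := fun _ => rfl
  smul_mem' := by
    intro c u hu n
    simp only [Pi.smul_apply, hu n]

/-- The `λ`-eigenspace of `−Δ_m` inside the space of functions on `K_m`. -/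
def eigensp (m : ℕ) (lam : ℝ) : Submodule ℝ (ZMod (Nm m) → ℝ) :=
  LinearMap.ker (lapL m - lam • LinearMap.id) ⊓ KFunSub m

/-- `c = (8 − √19)/3`, the smaller critical point of `R`. -/
def cpt : ℝ := (8 - Real.sqrt 19) / 3

/-- `φ₁`, the inverse of the (strictly increasing) restriction of `R` to `[0, c]`. -/
def phi1 : ℝ → ℝ := Function.invFunOn R (Set.Icc 0 cpt)

/-- Eigenvalue counting function: total dimension of the eigenspaces of `−Δ_m`
with eigenvalue `≤ t`. -/
def evCount (m : ℕ) (t : ℝ) : ℕ :=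
  Module.finrank ℝ ↥(⨆ lam ∈ Set.Iic t, eigensp m lam)

/-- `evSorted m k = λ_k(m)`, the `k`-th smallest eigenvalue (with multiplicity,
`1 ≤ k ≤ 5^m`) of `−Δ_m` acting on functions on `K_m`. -/
def evSorted (m k : ℕ) : ℝ := sInf {t : ℝ | k ≤ evCount m t}

/-- The restriction of a function on the circle `ℝ/ℤ` to the level-`m` vertices. -/
def restr (u : AddCircle (1 : ℝ) → ℝ) (m : ℕ) : ZMod (Nm m) → ℝ := fun n =>
  u (((n.val : ℝ) / (Nm m : ℝ) : ℝ) : AddCircle (1 : ℝ))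

/-- A continuous function on the circle is admissible if at every level its values
agree on identified pairs, so that its restrictions are functions on `K_m`. -/
def Admissible (u : AddCircle (1 : ℝ) → ℝ) : Prop :=
  Continuous u ∧ ∀ m, 1 ≤ m → ∀ n : ZMod (Nm m), restr u m (partner m n) = restr u m n

/-- `u` is a `λ`-eigenfunction of `−Δ` on `K`: it is admissible, nonzero, and
`sup_n |15^m (−Δ_m u_m)(n) − λ u(n/N_m)| → 0` as `m → ∞`. -/
def IsEigenK (lam : ℝ) (u : AddCircle (1 : ℝ) → ℝ) : Prop :=
  Admissible u ∧ u ≠ 0 ∧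
    ∀ ε : ℝ, 0 < ε → ∃ M : ℕ, ∀ m, M ≤ m → ∀ n : ZMod (Nm m),
      |(15 : ℝ) ^ m * lap m (restr u m) n - lam * restr u m n| < ε

/-- The symmetry-type subspace `V_{ε₁,ε₂}` of functions on `K_m`. -/
def symSub (m : ℕ) (e1 e2 : ℝ) : Submodule ℝ (ZMod (Nm m) → ℝ) where
  carrier := {u | IsKFun m u ∧ (∀ n, u (-n) = e1 * u n) ∧
    (∀ n, u (((5 ^ m : ℕ) : ZMod (Nm m)) - n) = e2 * u n)}
  add_mem' := by
    rintro u v ⟨hu, hu1, hu2⟩ ⟨hv, hv1, hv2⟩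
    refine ⟨fun n => by simp only [Pi.add_apply, hu n, hv n],
      fun n => by simp only [Pi.add_apply, hu1 n, hv1 n]; ring,
      fun n => by simp only [Pi.add_apply, hu2 n, hv2 n]; ring⟩
  zero_mem' := ⟨fun _ => rfl, fun n => by simp, fun n => by simp⟩
  smul_mem' := by
    rintro c u ⟨hu, hu1, hu2⟩
    refine ⟨fun n => by simp only [Pi.smul_apply, hu n],
      fun n => by simp only [Pi.smul_apply, smul_eq_mul, hu1 n]; ring,
      fun n => by simp only [Pi.smul_apply, smul_eq_mul, hu2 n]; ring⟩

theorem phi1_mem_and_ne_one {x : ℝ} (hx : x ∈ Set.Icc (0 : ℝ) (4 + Real.sqrt 2)) :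
    phi1 x ∈ Set.Icc (0 : ℝ) (4 + Real.sqrt 2) ∧ phi1 x ≠ 1 := by
  have h2 : Real.sqrt 2 < 2 := by rw [Real.sqrt_lt' (by norm_num)]; norm_num
  have h19 : Real.sqrt 19 < 5 := by rw [Real.sqrt_lt' (by norm_num)]; norm_num
  have h2' := Real.sqrt_nonneg 2
  have h19' := Real.sqrt_nonneg 19
  have hc : 1 ≤ cpt := by unfold cpt; linarith
  have hc' : cpt ≤ 4 := by unfold cpt; linarith
  have hR : Continuous R := by unfold R; fun_prop
  obtain ⟨y, hy, hyx⟩ := intermediate_value_Icc zero_le_one hR.continuousOn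
    (show x ∈ Set.Icc (R 0) (R 1) by
      constructor <;> norm_num [R] <;> linarith [hx.1, hx.2])
  have hex : ∃ a ∈ Set.Icc 0 cpt, R a = x := ⟨y, ⟨hy.1, hy.2.trans hc⟩, hyx⟩
  have hmem : phi1 x ∈ Set.Icc 0 cpt := Function.invFunOn_mem hex
  have heq : R (phi1 x) = x := Function.invFunOn_eq hex
  refine ⟨⟨hmem.1, by linarith [hmem.2]⟩, fun h => ?_⟩
  rw [h] at heq
  norm_num [R] at heq
  linarith [hx.2]

theorem middle_difference (n : ℕ) {l : ℝ} (hl : l ≠ 1) (a b : ℝ) :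
    (3 : ℝ) ^ (n + 1) * ((a + (2 - l) * b) / ((1 - l) * (3 - l)) -
      ((2 - l) * a + b) / ((1 - l) * (3 - l))) = (3 : ℝ) ^ n * (b - a) / (1 - l / 3) := by
  have h1 : 1 - l ≠ 0 := sub_ne_zero.mpr hl.symm
  rcases eq_or_ne l 3 with rfl | h3
  · norm_num
  · have h3' : 3 - l ≠ 0 := sub_ne_zero.mpr h3.symm
    have h3'' : 1 - l / 3 ≠ 0 := by
      intro h
      exact h3' (by linarith)
    field_simp
    ring

theorem middle_index_succ (j k : ℕ) :
    j * 3 ^ (k + 1) + (3 ^ (k + 1) - 1) / 2 = 3 * (j * 3 ^ k + (3 ^ k - 1) / 2) + 1 := by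
  have hodd : 3 ^ k % 2 = 1 := Nat.odd_iff.mp (Odd.pow (by decide))
  have hs : (3 ^ (k + 1) - 1) / 2 = 3 * ((3 ^ k - 1) / 2) + 1 := by
    rw [pow_succ]
    omega
  rw [hs, pow_succ]
  ring

theorem middle_index_lt {m j : ℕ} (k : ℕ) (hj : j < 3 ^ m) :
    j * 3 ^ k + (3 ^ k - 1) / 2 < 3 ^ (m + k) := by
  have hpos : 0 < 3 ^ k := by positivity
  calc j * 3 ^ k + (3 ^ k - 1) / 2 < j * 3 ^ k + 3 ^ k := by omega
    _ = (j + 1) * 3 ^ k := by ring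
    _ ≤ 3 ^ m * 3 ^ k := Nat.mul_le_mul_right _ hj
    _ = 3 ^ (m + k) := (pow_add _ _ _).symm

/-- Iterating the middle identity of (4.4): the difference quotient at
`j/3^m + 3^{-(m+1)} + ⋯ + 3^{-(m+k)}` (index `j·3^k + (3^k − 1)/2` at level `m + k`)
equals `D_m f(j/3^m) / ∏_{i=1}^k (1 − λ_{m+i}/3)`. -/
theorem difference_quotient_iterated
    (m₀ : ℕ) (hm₀ : 1 ≤ m₀) (lam : ℕ → ℝ)
    (hlam0 : lam m₀ ∈ Set.Icc (0 : ℝ) (4 + Real.sqrt 2))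
    (hlam : ∀ m, m₀ ≤ m → lam (m + 1) = phi1 (lam m))
    (f : ℕ → ℕ → ℝ)
    (hwrap : ∀ m, m₀ ≤ m → f m (3 ^ m) = f m 0)
    (hcons : ∀ m, m₀ ≤ m → ∀ j, j < 3 ^ m → f (m + 1) (3 * j) = f m j)
    (hrec1 : ∀ m, m₀ ≤ m → ∀ j, j < 3 ^ m →
      f (m + 1) (3 * j + 1) =
        ((2 - lam (m + 1)) * f m j + f m (j + 1)) /
          ((1 - lam (m + 1)) * (3 - lam (m + 1))))
    (hrec2 : ∀ m, m₀ ≤ m → ∀ j, j < 3 ^ m →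
      f (m + 1) (3 * j + 2) =
        (f m j + (2 - lam (m + 1)) * f m (j + 1)) /
          ((1 - lam (m + 1)) * (3 - lam (m + 1)))) :
    ∀ m, m₀ ≤ m → ∀ j, j < 3 ^ m → ∀ k, 1 ≤ k →
      (3 : ℝ) ^ (m + k) *
          (f (m + k) (j * 3 ^ k + (3 ^ k - 1) / 2 + 1) -
           f (m + k) (j * 3 ^ k + (3 ^ k - 1) / 2)) =
        ((3 : ℝ) ^ m * (f m (j + 1) - f m j)) /
          ∏ i ∈ Finset.Icc 1 k, (1 - lam (m + i) / 3) := by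
  have hmem : ∀ m, m₀ ≤ m → lam m ∈ Set.Icc (0 : ℝ) (4 + Real.sqrt 2) := by
    intro m hm
    induction m, hm using Nat.le_induction with
    | base => exact hlam0
    | succ n hn ih => exact hlam n hn ▸ (phi1_mem_and_ne_one ih).1
  have hne : ∀ m, m₀ ≤ m → lam (m + 1) ≠ 1 := fun m hm =>
    hlam m hm ▸ (phi1_mem_and_ne_one (hmem m hm)).2
  intro m hm j hj k _
  induction k with
  | zero => simp
  | succ k ih =>
    have hmk : m₀ ≤ m + k := hm.trans (Nat.le_add_right _ _)
    have hp := middle_index_lt k hj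
    rw [middle_index_succ, ← add_assoc m k 1, hrec2 _ hmk _ hp, hrec1 _ hmk _ hp,
      middle_difference _ (hne _ hmk), Finset.prod_Icc_succ_top (by omega), ← div_div]
    congr 1
    rcases Nat.eq_zero_or_pos k with rfl | hk
    · simp
    · exact ih hk

end VNLE
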